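/- arXiv:2509.03779 — 2 statements merged into one kernel-verified Lean document; each statement's English description precedes it below -/
import Mathlib

section
/- Let β ∈ (1,2) be real. If z ∈ ℂ satisfies E_{β,β}(z) = 0, then |arg z| > βπ/2; in particular every zero of E_{β,β} is nonzero and lies outside the closed sector {z : |arg z| ≤ βπ/2}. -/
open Real

/-- Mittag–Leffler function `E_{a,b}(z) = ∑ₖ zᵏ / Γ(a k + b)`. -/
noncomputable def mittagLeffler (a b : ℝ) (z : ℂ) : ℂ :=
  ∑' k : ℕ, z ^ k / Complex.Gamma ((a * k + b : ℝ) : ℂ)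

section

open MeasureTheory Set Filter Topology

theorem summable_pow_div_Gamma {a b x : ℝ} (ha : 1 ≤ a) (hb : 0 < b) (hx : 0 ≤ x) :
    Summable fun k : ℕ => x ^ k / Real.Gamma (a * k + b) := by
  rw [← summable_nat_add_iff 2]
  refine Summable.of_nonneg_of_le (fun k => ?_) (fun k => ?_)
    ((Real.summable_pow_div_factorial x).mul_left (x ^ 2))
  · exact div_nonneg (by positivity) (Real.Gamma_pos_of_pos (by positivity)).le
  · have h2 : (2 : ℝ) ≤ ((k + 1 : ℕ) : ℝ) + 1 := by push_cast; linarith [k.cast_nonneg (α := ℝ)]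
    have hle : ((k + 1 : ℕ) : ℝ) + 1 ≤ a * (k + 2 : ℕ) + b := by
      push_cast; nlinarith [k.cast_nonneg (α := ℝ)]
    have hG := Real.Gamma_strictMonoOn_Ici.monotoneOn h2 (h2.trans hle) hle
    rw [Real.Gamma_nat_eq_factorial] at hG
    have hf : (k.factorial : ℝ) ≤ ((k + 1).factorial : ℝ) := by
      exact_mod_cast Nat.factorial_le (Nat.le_succ k)
    have hk : (0 : ℝ) < k.factorial := by exact_mod_cast k.factorial_pos
    rw [mul_div_assoc', ← pow_add, add_comm 2 k]
    gcongr
    exact hf.trans hG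

theorem norm_pow_div_Gamma {a b : ℝ} (ha : 1 ≤ a) (hb : 0 < b) (z : ℂ) (k : ℕ) :
    ‖z ^ k / Complex.Gamma ((a * k + b : ℝ) : ℂ)‖ = ‖z‖ ^ k / Real.Gamma (a * k + b) := by
  have h : 0 < Real.Gamma (a * k + b) := Real.Gamma_pos_of_pos (by positivity)
  rw [Complex.Gamma_ofReal, norm_div, norm_pow, Complex.norm_real, Real.norm_of_nonneg h.le]

theorem hasSum_mittagLeffler {a b : ℝ} (ha : 1 ≤ a) (hb : 0 < b) (z : ℂ) :
    HasSum (fun k : ℕ => z ^ k / Complex.Gamma ((a * k + b : ℝ) : ℂ)) (mittagLeffler a b z) := by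
  refine (Summable.of_norm ?_).hasSum
  simp_rw [norm_pow_div_Gamma ha hb]
  exact summable_pow_div_Gamma ha hb (norm_nonneg z)

theorem continuous_mittagLeffler {a b : ℝ} (ha : 1 ≤ a) (hb : 0 < b) :
    Continuous (mittagLeffler a b) := by
  rw [continuous_iff_continuousAt]
  intro z
  have hc : ContinuousOn (mittagLeffler a b) (Metric.ball 0 (‖z‖ + 1)) := by
    refine continuousOn_tsum (fun k => by fun_prop)
      (summable_pow_div_Gamma ha hb (by positivity : 0 ≤ ‖z‖ + 1)) fun k w hw => ?_
    rw [norm_pow_div_Gamma ha hb]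
    have hw' : ‖w‖ ≤ ‖z‖ + 1 := (mem_ball_zero_iff.mp hw).le
    have : 0 ≤ Real.Gamma (a * k + b) := (Real.Gamma_pos_of_pos (by positivity)).le
    gcongr
  exact hc.continuousAt (Metric.isOpen_ball.mem_nhds (by simp))

theorem mittagLeffler_zero (a b : ℝ) : mittagLeffler a b 0 = (Complex.Gamma b)⁻¹ := by
  rw [mittagLeffler, tsum_eq_single 0]
  · simp
  · intro k hk; simp [hk]

theorem mittagLeffler_eq_inv_add {a b : ℝ} (ha : 1 ≤ a) (hb : 0 < b) (z : ℂ) :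
    mittagLeffler a b z = (Complex.Gamma b)⁻¹ + z * mittagLeffler a (a + b) z := by
  rw [mittagLeffler, (hasSum_mittagLeffler ha hb z).summable.tsum_eq_zero_add, mittagLeffler,
    ← tsum_mul_left]
  congr 1
  · simp
  · congr 1; ext k
    rw [pow_succ', mul_div_assoc]
    congr 4; push_cast; ring

theorem integral_rpow_mul_sub_rpow {p q t : ℝ} (hp : 0 < p) (hq : 0 < q) (ht : 0 < t) :
    ∫ x in 0..t, x ^ (p - 1) * (t - x) ^ (q - 1) =
      t ^ (p + q - 1) * (Real.Gamma p * Real.Gamma q / Real.Gamma (p + q)) := by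
  have h1 := Complex.betaIntegral_scaled p q ht
  have h2 := Complex.Gamma_mul_Gamma_eq_betaIntegral (s := p) (t := q) (by simpa) (by simpa)
  have h3 : Real.Gamma (p + q) ≠ 0 := (Real.Gamma_pos_of_pos (by positivity)).ne'
  have h4 : Complex.betaIntegral p q =
      ((Real.Gamma p * Real.Gamma q / Real.Gamma (p + q) : ℝ) : ℂ) := by
    rw [← Complex.ofReal_add] at h2
    simp only [Complex.Gamma_ofReal] at h2
    push_cast
    rw [h2, mul_div_cancel_left₀ _ (by exact_mod_cast h3)]
  rw [h4] at h1
  apply Complex.ofReal_injective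
  rw [← intervalIntegral.integral_ofReal, Complex.ofReal_mul, Complex.ofReal_cpow ht.le]
  push_cast at h1 ⊢
  rw [← h1]
  refine intervalIntegral.integral_congr fun x hx => ?_
  rw [uIcc_of_le ht.le] at hx
  rw [Complex.ofReal_cpow hx.1, Complex.ofReal_cpow (sub_nonneg.2 hx.2)]
  push_cast
  rfl

theorem intervalIntegrable_rpow_mul_sub_rpow {p q t : ℝ} (hp : 0 < p) (hq : 0 < q) (ht : 0 < t) :
    IntervalIntegrable (fun x => x ^ (p - 1) * (t - x) ^ (q - 1)) volume 0 t := by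
  apply intervalIntegral.intervalIntegrable_of_integral_ne_zero
  rw [integral_rpow_mul_sub_rpow hp hq ht]
  have := Real.Gamma_pos_of_pos hp
  have := Real.Gamma_pos_of_pos hq
  have := Real.Gamma_pos_of_pos (add_pos hp hq)
  positivity

theorem intervalIntegrable_ofReal {f : ℝ → ℝ} {a b : ℝ}
    (hf : IntervalIntegrable f volume a b) :
    IntervalIntegrable (fun x => (f x : ℂ)) volume a b :=
  ⟨hf.1.ofReal, hf.2.ofReal⟩

theorem integral_rpow_mul_mittagLeffler {a b p t : ℝ} (ha : 1 ≤ a) (hb : 0 < b) (hp : 0 < p)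
    (ht : 0 < t) (z : ℂ) :
    ∫ x in 0..t, ((x ^ (b - 1) * (t - x) ^ (p - 1) : ℝ) : ℂ) *
        mittagLeffler a b (z * (x ^ a : ℝ)) =
      Real.Gamma p * ((t ^ (b + p - 1) : ℝ) * mittagLeffler a (b + p) (z * (t ^ a : ℝ))) := by
  have hG : ∀ (c : ℝ), 0 < c → ∀ k : ℕ, 0 < Real.Gamma (a * k + c) :=
    fun c hc k => Real.Gamma_pos_of_pos (by positivity)
  have hb' : ∀ k : ℕ, 0 < a * k + b := fun k => by positivity
  let F : ℕ → ℝ → ℂ := fun k x =>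
    z ^ k / (Real.Gamma (a * k + b) : ℂ) *
      ((x ^ (a * k + b - 1) * (t - x) ^ (p - 1) : ℝ) : ℂ)
  have hFint : ∀ k, IntervalIntegrable (F k) volume 0 t := fun k =>
    IntervalIntegrable.const_mul (intervalIntegrable_ofReal
      (intervalIntegrable_rpow_mul_sub_rpow (hb' k) hp ht)) _
  have hFval : ∀ k, ∫ x in Ioc 0 t, F k x = Real.Gamma p * ((t ^ (b + p - 1) : ℝ) *
      ((z * (t ^ a : ℝ)) ^ k / Complex.Gamma ((a * k + (b + p) : ℝ) : ℂ))) := by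
    intro k
    rw [← intervalIntegral.integral_of_le ht.le, intervalIntegral.integral_const_mul,
      intervalIntegral.integral_ofReal, integral_rpow_mul_sub_rpow (hb' k) hp ht,
      Complex.Gamma_ofReal, mul_pow, ← Complex.ofReal_pow, ← Real.rpow_mul_natCast ht.le,
      show a * k + b + p - 1 = (b + p - 1) + a * k by ring, Real.rpow_add ht,
      show a * k + b + p = a * k + (b + p) by ring]
    have h1 : (Real.Gamma (a * k + b) : ℂ) ≠ 0 := by exact_mod_cast (hG b hb k).ne'
    have h2 : (Real.Gamma (a * k + (b + p)) : ℂ) ≠ 0 := by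
      exact_mod_cast (hG (b + p) (by positivity) k).ne'
    push_cast
    field_simp
  have hFnorm : ∀ k, ∫ x in Ioc 0 t, ‖F k x‖ = Real.Gamma p * (t ^ (b + p - 1) *
      ((‖z‖ * t ^ a) ^ k / Real.Gamma (a * k + (b + p)))) := by
    intro k
    have : ∀ x ∈ Ioc 0 t, ‖F k x‖ = ‖z‖ ^ k / Real.Gamma (a * k + b) *
        (x ^ (a * k + b - 1) * (t - x) ^ (p - 1)) := by
      intro x hx
      have h1 : 0 ≤ x ^ (a * k + b - 1) * (t - x) ^ (p - 1) :=
        mul_nonneg (Real.rpow_nonneg hx.1.le _) (Real.rpow_nonneg (sub_nonneg.2 hx.2) _)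
      simp only [F]
      rw [norm_mul, norm_div, norm_pow, Complex.norm_real, Complex.norm_real,
        Real.norm_of_nonneg h1, Real.norm_of_nonneg (hG b hb k).le]
    rw [setIntegral_congr_fun measurableSet_Ioc this,
      ← intervalIntegral.integral_of_le ht.le, intervalIntegral.integral_const_mul,
      integral_rpow_mul_sub_rpow (hb' k) hp ht, mul_pow, ← Real.rpow_mul_natCast ht.le,
      show a * k + b + p - 1 = (b + p - 1) + a * k by ring, Real.rpow_add ht,
      show a * k + b + p = a * k + (b + p) by ring]
    have h1 := (hG b hb k).ne'
    have h2 := (hG (b + p) (by positivity) k).ne'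
    field_simp
  have hsum : Summable fun k => ∫ x in Ioc 0 t, ‖F k x‖ := by
    simp_rw [hFnorm]
    exact ((summable_pow_div_Gamma ha (by positivity) (by positivity)).mul_left _).mul_left _
  have key := hasSum_integral_of_summable_integral_norm
    (fun k => (intervalIntegrable_iff_integrableOn_Ioc_of_le ht.le).1 (hFint k)) hsum
  simp_rw [hFval] at key
  have key2 := ((hasSum_mittagLeffler ha (add_pos hb hp) (z * (t ^ a : ℝ))).mul_left
    ((t ^ (b + p - 1) : ℝ) : ℂ)).mul_left (Real.Gamma p : ℂ)
  rw [key2.unique key, intervalIntegral.integral_of_le ht.le]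
  refine setIntegral_congr_fun measurableSet_Ioc fun x hx => ?_
  have key3 := (hasSum_mittagLeffler ha hb (z * (x ^ a : ℝ))).mul_left
    ((x ^ (b - 1) * (t - x) ^ (p - 1) : ℝ) : ℂ)
  rw [← key3.tsum_eq]
  congr 1; ext k
  simp only [F]
  rw [show a * k + b - 1 = (b - 1) + a * k by ring, Real.rpow_add hx.1, mul_pow,
    ← Complex.ofReal_pow, ← Real.rpow_mul_natCast hx.1.le, Complex.Gamma_ofReal]
  push_cast
  ring

theorem integrableOn_rpow_mul_exp_neg_mul {c ε : ℝ} (hc : 0 < c) (hε : 0 < ε) :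
    IntegrableOn (fun r : ℝ => r ^ (c - 1) * Real.exp (-(ε * r))) (Ioi 0) := by
  have h1 := Real.GammaIntegral_convergent hc
  have h2 := (integrableOn_Ioi_comp_mul_left_iff
    (fun x => Real.exp (-x) * x ^ (c - 1)) 0 hε).2 (by simpa using h1)
  refine (Integrable.const_mul h2 ((ε ^ (c - 1))⁻¹)).congr ?_
  refine (ae_restrict_iff' measurableSet_Ioi).2 (ae_of_all _ fun r hr => ?_)
  have h3 : ε ^ (c - 1) ≠ 0 := (Real.rpow_pos_of_pos hε _).ne'
  dsimp only
  rw [Real.mul_rpow hε.le (le_of_lt (mem_Ioi.1 hr))]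
  field_simp

theorem frequently_ofReal_nhdsNE {P : ℂ → Prop} {x : ℝ} (h : ∀ᶠ y : ℝ in 𝓝[>] x, P (y : ℂ)) :
    ∃ᶠ z in 𝓝[≠] (x : ℂ), P z := by
  have ht : Tendsto (fun y : ℝ => (y : ℂ)) (𝓝[>] x) (𝓝[≠] (x : ℂ)) := by
    refine tendsto_nhdsWithin_iff.2 ⟨?_, ?_⟩
    · exact (Complex.continuous_ofReal.tendsto x).mono_left nhdsWithin_le_nhds
    · filter_upwards [self_mem_nhdsWithin] with y hy
      simpa using (mem_Ioi.1 hy).ne'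
  exact ht.frequently h.frequently

theorem integral_rpow_mul_cexp_neg_mul_Ioi {c : ℝ} (hc : 0 < c) {s : ℂ} (hs : 0 < s.re) :
    ∫ r in Ioi (0 : ℝ), ((r ^ (c - 1) : ℝ) : ℂ) * Complex.exp (-(s * r)) =
      (1 / s) ^ (c : ℂ) * Complex.Gamma c := by
  have hU : IsOpen {s : ℂ | 0 < s.re} := isOpen_lt continuous_const Complex.continuous_re
  have hnorm : ∀ (s : ℂ) (r : ℝ), 0 < r → ‖((r ^ (c - 1) : ℝ) : ℂ) * Complex.exp (-(s * r))‖ =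
      r ^ (c - 1) * Real.exp (-(s.re * r)) := by
    intro s r hr
    rw [norm_mul, Complex.norm_real, Real.norm_of_nonneg (Real.rpow_nonneg hr.le _),
      Complex.norm_exp]
    simp
  have hmeas : ∀ s : ℂ, Measurable fun r : ℝ =>
      ((r ^ (c - 1) : ℝ) : ℂ) * Complex.exp (-(s * r)) := fun s => by fun_prop
  have hd1 : DifferentiableOn ℂ (fun s : ℂ =>
      ∫ r in Ioi (0 : ℝ), ((r ^ (c - 1) : ℝ) : ℂ) * Complex.exp (-(s * r))) {s : ℂ | 0 < s.re} := by
    intro s₀ hs₀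
    replace hs₀ : 0 < s₀.re := hs₀
    refine (hasDerivAt_integral_of_dominated_loc_of_deriv_le (s := {s : ℂ | s₀.re / 2 < s.re})
      (F' := fun (s : ℂ) (r : ℝ) => ((r ^ (c - 1) : ℝ) : ℂ) * (Complex.exp (-(s * r)) * (-r)))
      (bound := fun r => r ^ (c + 1 - 1) * Real.exp (-(s₀.re / 2 * r))) ?_ ?_ ?_ ?_ ?_ ?_
      ?_).2.differentiableAt.differentiableWithinAt
    · refine (isOpen_lt continuous_const Complex.continuous_re).mem_nhds ?_
      change s₀.re / 2 < s₀.re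
      linarith
    · exact Eventually.of_forall fun s => (hmeas s).aestronglyMeasurable
    · refine (integrableOn_rpow_mul_exp_neg_mul hc hs₀).mono' (hmeas s₀).aestronglyMeasurable ?_
      exact (ae_restrict_iff' measurableSet_Ioi).2 (ae_of_all _ fun r hr => (hnorm s₀ r hr).le)
    · exact Measurable.aestronglyMeasurable (by fun_prop)
    · refine (ae_restrict_iff' measurableSet_Ioi).2 (ae_of_all _ fun r hr s hs => ?_)
      replace hr : 0 < r := hr
      replace hs : s₀.re / 2 < s.re := hs
      rw [← mul_assoc, norm_mul, hnorm s r hr, norm_neg, Complex.norm_real,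
        Real.norm_of_nonneg hr.le, show c + 1 - 1 = c - 1 + 1 by ring, Real.rpow_add_one hr.ne',
        mul_right_comm]
      gcongr
    · exact integrableOn_rpow_mul_exp_neg_mul (by linarith) (by linarith)
    · refine ae_of_all _ fun r s _ => HasDerivAt.const_mul _ (HasDerivAt.cexp ?_)
      simpa using! ((hasDerivAt_id s).mul_const (r : ℂ)).neg
  have hd2 : DifferentiableOn ℂ (fun s : ℂ => (1 / s) ^ (c : ℂ) * Complex.Gamma c)
      {s : ℂ | 0 < s.re} := by
    intro s hs
    replace hs : 0 < s.re := hs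
    have h0 : s ≠ 0 := by rintro rfl; simp at hs
    refine DifferentiableAt.differentiableWithinAt ?_
    refine DifferentiableAt.mul_const (DifferentiableAt.cpow_const ?_ ?_) _
    · exact DifferentiableAt.div (by fun_prop) (by fun_prop) h0
    · left
      rw [one_div, Complex.inv_re]
      exact div_pos hs (Complex.normSq_pos.2 h0)
  refine (hd1.analyticOnNhd hU).eqOn_of_preconnected_of_frequently_eq (hd2.analyticOnNhd hU)
    (convex_halfSpace_re_gt 0).isPreconnected (z₀ := ((1 : ℝ) : ℂ)) (by simp)
    (frequently_ofReal_nhdsNE ?_) hs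
  filter_upwards [self_mem_nhdsWithin] with y hy
  rw [← Complex.integral_cpow_mul_exp_neg_mul_Ioi (a := c) (r := y) (by simpa)
    (one_pos.trans (mem_Ioi.1 hy))]
  refine setIntegral_congr_fun measurableSet_Ioi fun r hr => ?_
  rw [Complex.ofReal_cpow (le_of_lt (mem_Ioi.1 hr))]
  push_cast
  rfl

theorem norm_exp_I_mul_mul (r x : ℝ) : ‖Complex.exp (Complex.I * r * x)‖ = 1 := by
  have : Complex.I * r * x = ((r * x : ℝ) : ℂ) * Complex.I := by push_cast; ring
  rw [this, Complex.norm_exp_ofReal_mul_I]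

theorem continuous_integral_exp_mul {μ : Measure ℝ} {w : ℝ → ℂ} (hw : Integrable w μ) :
    Continuous fun r : ℝ => ∫ x, Complex.exp (Complex.I * r * x) * w x ∂μ := by
  refine continuous_of_dominated (bound := fun x => ‖w x‖) (fun r => ?_) (fun r => ?_) hw.norm ?_
  · exact AEStronglyMeasurable.mul (Continuous.aestronglyMeasurable (by fun_prop))
      hw.aestronglyMeasurable
  · exact ae_of_all _ fun x => by rw [norm_mul, norm_exp_I_mul_mul, one_mul]
  · exact ae_of_all _ fun x => by fun_prop

theorem integrableOn_rpow_mul_exp_mul_norm_sq {μ : Measure ℝ} {w : ℝ → ℂ} (hw : Integrable w μ)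
    {c ε : ℝ} (hc : 0 < c) (hε : 0 < ε) :
    IntegrableOn (fun r : ℝ => r ^ (c - 1) * Real.exp (-(ε * r)) *
      ‖∫ x, Complex.exp (Complex.I * r * x) * w x ∂μ‖ ^ 2) (Ioi 0) := by
  refine Integrable.mul_bdd (c := (∫ x, ‖w x‖ ∂μ) ^ 2)
    (integrableOn_rpow_mul_exp_neg_mul hc hε) ?_ (ae_of_all _ fun r => ?_)
  · exact ((continuous_integral_exp_mul hw).norm.pow 2).aestronglyMeasurable
  · rw [norm_pow, norm_norm]
    gcongr
    refine (norm_integral_le_integral_norm _).trans_eq ?_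
    simp_rw [norm_mul, norm_exp_I_mul_mul, one_mul]

open ComplexConjugate in
theorem integral_prod_mul_conj_mul_cpow {μ : Measure ℝ} [SFinite μ] {w : ℝ → ℂ}
    (hw : Integrable w μ) {c ε : ℝ} (hc : 0 < c) (hε : 0 < ε) :
    Complex.Gamma c * ∫ p : ℝ × ℝ, w p.1 * conj (w p.2) *
        (1 / ((ε : ℂ) + Complex.I * ((p.2 - p.1 : ℝ) : ℂ))) ^ (c : ℂ) ∂(μ.prod μ) =
      ((∫ r in Ioi (0 : ℝ), r ^ (c - 1) * Real.exp (-(ε * r)) *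
        ‖∫ x, Complex.exp (Complex.I * r * x) * w x ∂μ‖ ^ 2 : ℝ) : ℂ) := by
  have hwc : Integrable (fun x => conj (w x)) μ := by
    simpa using (Complex.conjLIE.toContinuousLinearEquiv.integrable_comp_iff).2 hw
  let f : ℝ × ℝ → ℂ := fun p => w p.1 * conj (w p.2)
  have hf : Integrable f (μ.prod μ) := hw.mul_prod hwc
  let g : ℝ → ℂ := fun r => ((r ^ (c - 1) * Real.exp (-(ε * r)) : ℝ) : ℂ)
  have hg : Integrable g (volume.restrict (Ioi 0)) :=
    (integrableOn_rpow_mul_exp_neg_mul hc hε).ofReal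
  let h : (ℝ × ℝ) × ℝ → ℂ := fun q => Complex.exp (-(Complex.I * ((q.1.2 - q.1.1 : ℝ) : ℂ) * q.2))
  have hh : ∀ q, ‖h q‖ = 1 := by
    intro q
    have : -(Complex.I * ((q.1.2 - q.1.1 : ℝ) : ℂ) * q.2) =
        ((-((q.1.2 - q.1.1) * q.2) : ℝ) : ℂ) * Complex.I := by push_cast; ring
    simp only [h]
    rw [this, Complex.norm_exp_ofReal_mul_I]
  have hG : Integrable (fun q : (ℝ × ℝ) × ℝ => h q * (f q.1 * g q.2))
      ((μ.prod μ).prod (volume.restrict (Ioi 0))) := by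
    refine (hf.mul_prod hg).bdd_mul (c := 1) ?_ (ae_of_all _ fun q => (hh q).le)
    exact Continuous.aestronglyMeasurable (by fun_prop)
  have hswap := integral_integral_swap (f := fun p r => h (p, r) * (f p * g r)) hG
  have hL : ∀ p : ℝ × ℝ, ∫ r in Ioi (0 : ℝ), h (p, r) * (f p * g r) =
      Complex.Gamma c * (f p *
        (1 / ((ε : ℂ) + Complex.I * ((p.2 - p.1 : ℝ) : ℂ))) ^ (c : ℂ)) := by
    intro p
    rw [mul_comm (Complex.Gamma c), mul_assoc, ← integral_rpow_mul_cexp_neg_mul_Ioi hc (by simpa),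
      ← integral_const_mul]
    refine setIntegral_congr_fun measurableSet_Ioi fun r hr => ?_
    simp only [h, g, Complex.ofReal_mul]
    rw [add_mul, neg_add, Complex.exp_add]
    push_cast
    ring
  have hR : ∀ r : ℝ, ∫ p, h (p, r) * (f p * g r) ∂(μ.prod μ) =
      ((r ^ (c - 1) * Real.exp (-(ε * r)) *
        ‖∫ x, Complex.exp (Complex.I * r * x) * w x ∂μ‖ ^ 2 : ℝ) : ℂ) := by
    intro r
    have h1 : ∀ p : ℝ × ℝ, h (p, r) * (f p * g r) =
        g r * ((Complex.exp (Complex.I * r * p.1) * w p.1) *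
          conj (Complex.exp (Complex.I * r * p.2) * w p.2)) := by
      intro p
      have : h (p, r) = Complex.exp (Complex.I * r * p.1) *
          conj (Complex.exp (Complex.I * r * p.2)) := by
        simp only [h]
        rw [← Complex.exp_conj, ← Complex.exp_add]
        congr 1
        simp
        ring
      rw [this, map_mul]
      simp only [f]
      ring
    simp_rw [h1]
    rw [integral_const_mul, integral_prod_mul (fun x : ℝ => Complex.exp (Complex.I * r * x) * w x)
      (fun x : ℝ => conj (Complex.exp (Complex.I * r * x) * w x)), integral_conj,
      Complex.mul_conj, Complex.normSq_eq_norm_sq]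
    simp only [g]
    push_cast
    ring
  simp_rw [hL, hR] at hswap
  rw [integral_const_mul] at hswap
  exact hswap.trans integral_ofReal

open ComplexConjugate in
theorem integral_le_re_kernel {μ : Measure ℝ} [SFinite μ] [NullSingletonClass μ] {w : ℝ → ℂ}
    (hw : Integrable w μ) {c : ℝ} (hc : 0 < c)
    (hK : Integrable (fun p : ℝ × ℝ => ‖w p.1‖ * ‖w p.2‖ * |p.2 - p.1| ^ (-c)) (μ.prod μ)) :
    ∫ r in Ioi (0 : ℝ), r ^ (c - 1) * Real.exp (-r) *
        ‖∫ x, Complex.exp (Complex.I * r * x) * w x ∂μ‖ ^ 2 ≤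
      (Complex.Gamma c * ∫ p : ℝ × ℝ, w p.1 * conj (w p.2) *
        (1 / (Complex.I * ((p.2 - p.1 : ℝ) : ℂ))) ^ (c : ℂ) ∂(μ.prod μ)).re := by
  have hdiag : ∀ᵐ p ∂(μ.prod μ), p.1 ≠ p.2 := by
    have : (μ.prod μ) {p : ℝ × ℝ | p.1 = p.2} = 0 := by
      rw [Measure.measure_prod_null (isClosed_eq continuous_fst continuous_snd).measurableSet]
      refine ae_of_all _ fun x => ?_
      have : Prod.mk x ⁻¹' {p : ℝ × ℝ | p.1 = p.2} = {x} := by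
        ext y; simp [eq_comm]
      simp [this]
    simpa [ae_iff] using this
  have hmeas : AEStronglyMeasurable (fun p : ℝ × ℝ => w p.1 * conj (w p.2)) (μ.prod μ) := by
    have h1 := hw.aestronglyMeasurable
    exact (h1.comp_fst).mul (Complex.continuous_conj.comp_aestronglyMeasurable h1.comp_snd)
  have hlim : Tendsto (fun ε : ℝ => (Complex.Gamma c * ∫ p : ℝ × ℝ, w p.1 * conj (w p.2) *
        (1 / ((ε : ℂ) + Complex.I * ((p.2 - p.1 : ℝ) : ℂ))) ^ (c : ℂ) ∂(μ.prod μ)).re)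
      (𝓝[>] 0) (𝓝 (Complex.Gamma c * ∫ p : ℝ × ℝ, w p.1 * conj (w p.2) *
        (1 / (Complex.I * ((p.2 - p.1 : ℝ) : ℂ))) ^ (c : ℂ) ∂(μ.prod μ)).re) := by
    refine (Complex.continuous_re.tendsto _).comp (Tendsto.const_mul _ ?_)
    refine tendsto_integral_filter_of_dominated_convergence _ ?_ ?_ hK ?_
    · filter_upwards [self_mem_nhdsWithin] with ε hε
      refine hmeas.mul (Measurable.aestronglyMeasurable ?_)
      fun_prop
    · filter_upwards [self_mem_nhdsWithin] with ε hε
      filter_upwards [hdiag] with p hp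
      rw [norm_mul, norm_mul, RCLike.norm_conj, Complex.norm_cpow_real, one_div, norm_inv,
        Real.inv_rpow (norm_nonneg _), ← Real.rpow_neg (norm_nonneg _)]
      refine mul_le_mul_of_nonneg_left ?_ (by positivity)
      refine Real.rpow_le_rpow_of_nonpos (abs_pos.2 (sub_ne_zero.2 hp.symm)) ?_ (by linarith)
      have := Complex.abs_im_le_norm ((ε : ℂ) + Complex.I * ((p.2 - p.1 : ℝ) : ℂ))
      simpa using this
    · filter_upwards [hdiag] with p hp
      have hp' : p.2 - p.1 ≠ 0 := sub_ne_zero.2 hp.symm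
      refine Tendsto.const_mul _ ((continuousAt_cpow_const ?_).tendsto.comp ?_)
      · right
        rw [one_div, mul_inv, Complex.inv_I, ← Complex.ofReal_inv]
        have h1 : (p.2 - p.1)⁻¹ ≠ 0 := inv_ne_zero hp'
        rwa [neg_mul, Complex.neg_im, Complex.I_mul_im, Complex.ofReal_re, neg_ne_zero]
      · refine Tendsto.div tendsto_const_nhds ?_ ?_
        · have : Tendsto (fun ε : ℝ => (ε : ℂ) + Complex.I * ((p.2 - p.1 : ℝ) : ℂ)) (𝓝 0)
              (𝓝 (((0 : ℝ) : ℂ) + Complex.I * ((p.2 - p.1 : ℝ) : ℂ))) :=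
            Continuous.tendsto (by fun_prop) 0
          simp only [Complex.ofReal_zero, zero_add] at this
          exact this.mono_left nhdsWithin_le_nhds
        · exact mul_ne_zero Complex.I_ne_zero (by exact_mod_cast hp')
  refine ge_of_tendsto hlim ?_
  filter_upwards [Ioo_mem_nhdsGT (zero_lt_one' ℝ)] with ε hε
  rw [integral_prod_mul_conj_mul_cpow hw hc hε.1, Complex.ofReal_re]
  refine integral_mono_of_nonneg ?_ (integrableOn_rpow_mul_exp_mul_norm_sq hw hc hε.1) ?_ <;>
    refine (ae_restrict_iff' measurableSet_Ioi).2 (ae_of_all _ fun r hr => ?_)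
  · have : 0 ≤ r ^ (c - 1) := Real.rpow_nonneg (le_of_lt (mem_Ioi.1 hr)) _
    simp only [Pi.zero_apply]
    positivity
  · have : 0 ≤ r ^ (c - 1) := Real.rpow_nonneg (le_of_lt (mem_Ioi.1 hr)) _
    dsimp only
    gcongr
    nlinarith [mem_Ioi.1 hr, hε.2]

open ComplexConjugate in
theorem integral_le_re_half_kernel {μ : Measure ℝ} [SFinite μ] [NullSingletonClass μ] {w : ℝ → ℂ}
    (hw : Integrable w μ) {c : ℝ} (hc : 0 < c)
    (hK : Integrable (fun p : ℝ × ℝ => {p : ℝ × ℝ | p.1 < p.2}.indicator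
      (fun p => w p.1 * conj (w p.2) * ((p.2 - p.1) ^ (-c) : ℝ)) p) (μ.prod μ)) :
    ∫ r in Ioi (0 : ℝ), r ^ (c - 1) * Real.exp (-r) *
        ‖∫ x, Complex.exp (Complex.I * r * x) * w x ∂μ‖ ^ 2 ≤
      2 * Real.Gamma c * (Complex.exp (-(c * (Real.pi / 2)) * Complex.I) *
        ∫ p : ℝ × ℝ, {p : ℝ × ℝ | p.1 < p.2}.indicator
      (fun p => w p.1 * conj (w p.2) * ((p.2 - p.1) ^ (-c) : ℝ)) p ∂(μ.prod μ)).re := by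
  set A : ℝ × ℝ → ℂ := fun p => {p : ℝ × ℝ | p.1 < p.2}.indicator
      (fun p => w p.1 * conj (w p.2) * ((p.2 - p.1) ^ (-c) : ℝ)) p with hA
  set e : ℂ := Complex.exp (-(c * (Real.pi / 2)) * Complex.I) with he
  have hcpow : ∀ x : ℝ, 0 < x → (1 / (Complex.I * (x : ℂ))) ^ (c : ℂ) = (x ^ (-c) : ℝ) * e := by
    intro x hx
    have h1 : 1 / (Complex.I * (x : ℂ)) = ((x⁻¹ : ℝ) : ℂ) * (-Complex.I) := by
      rw [one_div, mul_inv, Complex.inv_I]; push_cast; ring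
    have h0 : ((x⁻¹ : ℝ) : ℂ) ≠ 0 := by exact_mod_cast (inv_pos.2 hx).ne'
    rw [h1, Complex.cpow_def_of_ne_zero (mul_ne_zero h0 (neg_ne_zero.2 Complex.I_ne_zero)),
      Complex.log_ofReal_mul (inv_pos.2 hx) (neg_ne_zero.2 Complex.I_ne_zero), Complex.log_neg_I,
      add_mul, Complex.exp_add, Real.rpow_def_of_pos hx, Real.log_inv, he]
    push_cast
    congr 2 <;> ring
  have hconj : ∀ x : ℝ, (1 / (Complex.I * ((-x : ℝ) : ℂ))) ^ (c : ℂ) =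
      conj ((1 / (Complex.I * (x : ℂ))) ^ (c : ℂ)) := by
    intro x
    rcases eq_or_ne x 0 with rfl | hx
    · simp [hc.ne']
    · have h1 : 1 / (Complex.I * ((-x : ℝ) : ℂ)) = conj (1 / (Complex.I * (x : ℂ))) := by simp
      rw [h1, Complex.conj_cpow, Complex.conj_ofReal]
      rw [one_div, mul_inv, Complex.inv_I, ← Complex.ofReal_inv, Ne, Complex.arg_eq_pi_iff]
      simp
  have hH : ∀ p : ℝ × ℝ, w p.1 * conj (w p.2) *
      (1 / (Complex.I * ((p.2 - p.1 : ℝ) : ℂ))) ^ (c : ℂ) = e * A p + conj (e * A p.swap) := by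
    intro p
    rcases lt_trichotomy p.1 p.2 with h | h | h
    · have h' : ¬ p.2 < p.1 := h.not_gt
      simp only [hA, indicator, mem_ofPred_eq, h, if_true, Prod.fst_swap, Prod.snd_swap, h', if_false]
      rw [hcpow _ (sub_pos.2 h)]
      simp
      ring
    · simp [hA, h, hc.ne']
    · have h' : ¬ p.1 < p.2 := h.not_gt
      simp only [hA, indicator, mem_ofPred_eq, h, if_true, Prod.fst_swap, Prod.snd_swap, h', if_false]
      rw [← neg_sub p.1 p.2, hconj, hcpow _ (sub_pos.2 h)]
      simp
      ring
  have hnorm : Integrable (fun p : ℝ × ℝ => ‖w p.1‖ * ‖w p.2‖ * |p.2 - p.1| ^ (-c)) (μ.prod μ) := by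
    refine (hK.norm.add hK.swap.norm).congr (ae_of_all _ fun p => ?_)
    rcases lt_trichotomy p.1 p.2 with h | h | h
    · have h' : ¬ p.2 < p.1 := h.not_gt
      simp [hA, indicator, h, h', abs_of_pos (sub_pos.2 h),
        abs_of_nonneg (Real.rpow_nonneg (sub_pos.2 h).le (-c))]
    · simp [hA, h, hc.ne']
    · have h' : ¬ p.1 < p.2 := h.not_gt
      simp [hA, indicator, h, h', abs_of_neg (sub_neg.2 h),
        abs_of_nonneg (Real.rpow_nonneg (sub_pos.2 h).le (-c))]
      exact Or.inl (mul_comm _ _)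
  have h := integral_le_re_kernel hw hc hnorm
  simp_rw [hH] at h
  have hconjint : Integrable (fun p : ℝ × ℝ => conj (e * A p.swap)) (μ.prod μ) :=
    (Complex.conjLIE.toContinuousLinearEquiv.integrable_comp_iff).2 (hK.swap.const_mul e)
  rw [integral_add (hK.const_mul e) hconjint, integral_conj, integral_const_mul,
    integral_const_mul, integral_prod_swap, Complex.add_conj, Complex.Gamma_ofReal,
    ← Complex.ofReal_mul, Complex.ofReal_re] at h
  refine h.trans_eq ?_
  ring

/-- The function `t ↦ t ^ (b - 1) * E_{a,b}(z * t ^ a)`. -/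
noncomputable def mittagLefflerKernel (a b : ℝ) (z : ℂ) (t : ℝ) : ℂ :=
  ((t ^ (b - 1) : ℝ) : ℂ) * mittagLeffler a b (z * (t ^ a : ℝ))

theorem continuous_mittagLeffler_mul_rpow {a b : ℝ} (ha : 1 ≤ a) (hb : 0 < b) (z : ℂ) :
    Continuous fun t : ℝ => mittagLeffler a b (z * (t ^ a : ℝ)) := by
  have h := Real.continuous_rpow_const (q := a) (by linarith)
  exact (continuous_mittagLeffler ha hb).comp (by fun_prop)

theorem continuous_mittagLefflerKernel {a b : ℝ} (ha : 1 ≤ a) (hb : 1 ≤ b) (z : ℂ) :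
    Continuous (mittagLefflerKernel a b z) := by
  have h := Real.continuous_rpow_const (q := b - 1) (by linarith)
  exact (Complex.continuous_ofReal.comp h).mul
    (continuous_mittagLeffler_mul_rpow ha (by linarith) z)

theorem continuousAt_mittagLefflerKernel {a b t : ℝ} (ha : 1 ≤ a) (hb : 0 < b) (z : ℂ)
    (ht : 0 < t) : ContinuousAt (mittagLefflerKernel a b z) t := by
  have h := Real.continuousAt_rpow_const t (b - 1) (Or.inl ht.ne')
  exact (Complex.continuous_ofReal.continuousAt.comp h).mul
    (continuous_mittagLeffler_mul_rpow ha hb z).continuousAt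

theorem measurable_mittagLefflerKernel {a b : ℝ} (ha : 1 ≤ a) (hb : 0 < b) (z : ℂ) :
    Measurable (mittagLefflerKernel a b z) :=
  Measurable.mul (by fun_prop) (continuous_mittagLeffler_mul_rpow ha hb z).measurable

theorem intervalIntegrable_mittagLefflerKernel {a b : ℝ} (ha : 1 ≤ a) (hb : 0 < b) (z : ℂ)
    (s t : ℝ) : IntervalIntegrable (mittagLefflerKernel a b z) volume s t := by
  refine IntervalIntegrable.mul_continuousOn ?_
    (continuous_mittagLeffler_mul_rpow ha hb z).continuousOn
  exact intervalIntegrable_ofReal (intervalIntegral.intervalIntegrable_rpow' (by linarith))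

theorem mittagLefflerKernel_zero {a b : ℝ} (hb : 1 < b) (z : ℂ) :
    mittagLefflerKernel a b z 0 = 0 := by
  simp [mittagLefflerKernel, Real.zero_rpow (sub_pos.2 hb).ne']

theorem integral_rpow_mul_mittagLefflerKernel {a b p t : ℝ} (ha : 1 ≤ a) (hb : 0 < b) (hp : 0 < p)
    (ht : 0 < t) (z : ℂ) :
    ∫ x in 0..t, (((t - x) ^ (p - 1) : ℝ) : ℂ) * mittagLefflerKernel a b z x =
      Real.Gamma p * mittagLefflerKernel a (b + p) z t := by
  simp only [mittagLefflerKernel]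
  rw [← integral_rpow_mul_mittagLeffler ha hb hp ht]
  congr 1; ext x
  push_cast
  ring

theorem integral_mittagLefflerKernel {a b t : ℝ} (ha : 1 ≤ a) (hb : 0 < b) (ht : 0 < t) (z : ℂ) :
    ∫ x in 0..t, mittagLefflerKernel a b z x = mittagLefflerKernel a (b + 1) z t := by
  simpa using integral_rpow_mul_mittagLefflerKernel ha hb one_pos ht z

theorem hasDerivAt_mittagLefflerKernel {a b t : ℝ} (ha : 1 ≤ a) (hb : 0 < b) (ht : 0 < t) (z : ℂ) :
    HasDerivAt (mittagLefflerKernel a (b + 1) z) (mittagLefflerKernel a b z t) t := by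
  have h := intervalIntegral.integral_hasDerivAt_right
    (intervalIntegrable_mittagLefflerKernel ha hb z 0 t)
    (measurable_mittagLefflerKernel ha hb z).stronglyMeasurable.stronglyMeasurableAtFilter
    (continuousAt_mittagLefflerKernel ha hb z ht)
  refine h.congr_of_eventuallyEq ?_
  filter_upwards [lt_mem_nhds ht] with s hs
  rw [integral_mittagLefflerKernel ha hb hs]

theorem mittagLefflerKernel_one {a t : ℝ} (ha : 1 ≤ a) (z : ℂ) :
    mittagLefflerKernel a 1 z t = 1 + z * mittagLefflerKernel a (a + 1) z t := by
  simp only [mittagLefflerKernel]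
  rw [mittagLeffler_eq_inv_add ha one_pos]
  simp
  ring

theorem hasDerivAt_mittagLefflerKernel_one {a t : ℝ} (ha : 1 ≤ a) (ht : 0 < t) (z : ℂ) :
    HasDerivAt (mittagLefflerKernel a 1 z) (z * mittagLefflerKernel a a z t) t := by
  rw [funext fun t => mittagLefflerKernel_one (t := t) ha z]
  exact ((hasDerivAt_mittagLefflerKernel ha (by linarith) ht z).const_mul z).const_add 1

open ComplexConjugate in
theorem integral_kernel_one_mul_conj {β : ℝ} (hβ : 1 < β) {z : ℂ}
    (hz : mittagLeffler β β z = 0) :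
    ∫ t in 0..1, mittagLefflerKernel β 1 z t * conj (mittagLefflerKernel β (β - 1) z t) =
      -z * ((∫ t in 0..1, ‖mittagLefflerKernel β β z t‖ ^ 2 : ℝ) : ℂ) := by
  have h1 : mittagLefflerKernel β β z 1 = 0 := by simp [mittagLefflerKernel, hz]
  have hc := continuous_mittagLefflerKernel hβ.le hβ.le z
  have hI := intervalIntegrable_mittagLefflerKernel hβ.le (sub_pos.2 hβ) z 0 1
  rw [intervalIntegral.integral_mul_deriv_eq_deriv_mul_of_hasDerivAt
    (u' := fun t => z * mittagLefflerKernel β β z t)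
    (v := fun t => conj (mittagLefflerKernel β β z t))
    (v' := fun t => conj (mittagLefflerKernel β (β - 1) z t))
    (continuous_mittagLefflerKernel hβ.le le_rfl z).continuousOn
    (Complex.continuous_conj.comp hc).continuousOn ?_ ?_
    ((continuous_const.mul hc).intervalIntegrable _ _)
    ⟨(Complex.conjLIE.toContinuousLinearEquiv.integrable_comp_iff).2 hI.1,
      (Complex.conjLIE.toContinuousLinearEquiv.integrable_comp_iff).2 hI.2⟩]
  · rw [h1, mittagLefflerKernel_zero hβ, ← intervalIntegral.integral_ofReal,
      ← intervalIntegral.integral_const_mul]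
    simp only [map_zero, mul_zero, sub_zero, zero_sub, ← intervalIntegral.integral_neg]
    congr 1; ext t
    rw [mul_assoc, Complex.mul_conj, Complex.normSq_eq_norm_sq]
    ring
  · intro x hx
    exact hasDerivAt_mittagLefflerKernel_one hβ.le (by simpa using hx.1) z
  · intro x hx
    have := hasDerivAt_mittagLefflerKernel hβ.le (sub_pos.2 hβ) (by simpa using hx.1) z
    rw [sub_add_cancel] at this
    exact this.star

theorem integrableOn_mittagLefflerKernel {a b : ℝ} (ha : 1 ≤ a) (hb : 0 < b) (z : ℂ) :
    IntegrableOn (mittagLefflerKernel a b z) (Ioc 0 1) :=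
  (intervalIntegrable_iff_integrableOn_Ioc_of_le zero_le_one).1
    (intervalIntegrable_mittagLefflerKernel ha hb z 0 1)

theorem exists_norm_mittagLefflerKernel_le {a b : ℝ} (ha : 1 ≤ a) (hb : 0 < b) (z : ℂ) :
    ∃ C, ∀ t ∈ Ioc (0 : ℝ) 1, ‖mittagLefflerKernel a b z t‖ ≤ C * t ^ (b - 1) := by
  obtain ⟨C, hC⟩ := (isCompact_Icc (a := (0 : ℝ)) (b := 1)).exists_bound_of_continuousOn
    (continuous_mittagLeffler_mul_rpow ha hb z).continuousOn
  refine ⟨C, fun t ht => ?_⟩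
  have h := Real.rpow_nonneg ht.1.le (b - 1)
  rw [mittagLefflerKernel, norm_mul, Complex.norm_real, Real.norm_of_nonneg h, mul_comm]
  exact mul_le_mul_of_nonneg_right (hC t ⟨ht.1.le, ht.2⟩) h

theorem restrict_Ioc_restrict_Iio {t : ℝ} (ht : t ≤ 1) :
    ((volume : Measure ℝ).restrict (Ioc 0 1)).restrict (Iio t) = volume.restrict (Ioo 0 t) := by
  rw [Measure.restrict_restrict measurableSet_Iio]
  congr 1
  ext x
  simp only [mem_inter_iff, mem_Iio, mem_Ioc, mem_Ioo]
  constructor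
  · rintro ⟨h1, h2, h3⟩; exact ⟨h2, h1⟩
  · rintro ⟨h1, h2⟩; exact ⟨h2, h1, by linarith⟩

theorem setIntegral_Ioc_indicator_Iio {E : Type*} [NormedAddCommGroup E] [NormedSpace ℝ E]
    {t : ℝ} (ht0 : 0 < t) (ht : t ≤ 1) (f : ℝ → E) :
    ∫ x in Ioc 0 1, (Iio t).indicator f x = ∫ x in 0..t, f x := by
  rw [integral_indicator measurableSet_Iio, restrict_Ioc_restrict_Iio ht,
    intervalIntegral.integral_of_le ht0.le, integral_Ioc_eq_integral_Ioo]

theorem integrable_indicator_rpow {c : ℝ} (hc0 : 0 < c) (hc1 : c < 1) :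
    Integrable (fun p : ℝ × ℝ => {p : ℝ × ℝ | p.1 < p.2}.indicator
      (fun p => p.1 ^ (c - 1) * p.2 ^ (c - 1) * (p.2 - p.1) ^ (-c)) p)
      ((volume.restrict (Ioc 0 1)).prod (volume.restrict (Ioc 0 1))) := by
  have hm : Measurable (fun p : ℝ × ℝ => {p : ℝ × ℝ | p.1 < p.2}.indicator
      (fun p => p.1 ^ (c - 1) * p.2 ^ (c - 1) * (p.2 - p.1) ^ (-c)) p) :=
    Measurable.indicator (by fun_prop) (measurableSet_lt measurable_fst measurable_snd)
  have hs : ∀ t x : ℝ, {p : ℝ × ℝ | p.1 < p.2}.indicator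
      (fun p => p.1 ^ (c - 1) * p.2 ^ (c - 1) * (p.2 - p.1) ^ (-c)) (x, t) =
      (Iio t).indicator (fun x => t ^ (c - 1) * (x ^ (c - 1) * (t - x) ^ (1 - c - 1))) x := by
    intro t x
    simp only [indicator, mem_ofPred_eq, mem_Iio, show 1 - c - 1 = -c by ring]
    split_ifs <;> ring
  rw [integrable_prod_iff' hm.aestronglyMeasurable]
  constructor
  · refine (ae_restrict_iff' measurableSet_Ioc).2 (ae_of_all _ fun t ht => ?_)
    simp_rw [hs]
    rw [integrable_indicator_iff measurableSet_Iio, IntegrableOn, restrict_Ioc_restrict_Iio ht.2]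
    refine Integrable.const_mul ?_ _
    have := intervalIntegrable_rpow_mul_sub_rpow hc0 (sub_pos.2 hc1) ht.1
    rwa [intervalIntegrable_iff_integrableOn_Ioo_of_le ht.1.le] at this
  · have h1 : IntegrableOn (fun t : ℝ => t ^ (c - 1)) (Ioc 0 1) :=
      (intervalIntegrable_iff_integrableOn_Ioc_of_le zero_le_one).1
        (intervalIntegral.intervalIntegrable_rpow' (by linarith))
    refine (Integrable.mul_const h1 (Real.Gamma c * Real.Gamma (1 - c))).congr ?_
    refine (ae_restrict_iff' measurableSet_Ioc).2 (ae_of_all _ fun t ht => ?_)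
    have h2 : ∀ x ∈ Ioc (0 : ℝ) 1, ‖(Iio t).indicator
        (fun x => t ^ (c - 1) * (x ^ (c - 1) * (t - x) ^ (1 - c - 1))) x‖ =
        (Iio t).indicator (fun x => t ^ (c - 1) * (x ^ (c - 1) * (t - x) ^ (1 - c - 1))) x := by
      intro x hx
      refine Real.norm_of_nonneg (indicator_apply_nonneg fun hxt => ?_)
      exact mul_nonneg (Real.rpow_nonneg ht.1.le _) (mul_nonneg (Real.rpow_nonneg hx.1.le _)
        (Real.rpow_nonneg (sub_pos.2 hxt).le _))
    simp_rw [hs]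
    rw [setIntegral_congr_fun measurableSet_Ioc h2, setIntegral_Ioc_indicator_Iio ht.1 ht.2,
      intervalIntegral.integral_const_mul, integral_rpow_mul_sub_rpow hc0 (sub_pos.2 hc1) ht.1]
    simp

open ComplexConjugate in
theorem integrable_indicator_kernel {β : ℝ} (hβ1 : 1 < β) (hβ2 : β < 2) (z : ℂ) :
    Integrable (fun p : ℝ × ℝ => {p : ℝ × ℝ | p.1 < p.2}.indicator
      (fun p => mittagLefflerKernel β (β - 1) z p.1 * conj (mittagLefflerKernel β (β - 1) z p.2) *
        ((p.2 - p.1) ^ (-(β - 1)) : ℝ)) p)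
      ((volume.restrict (Ioc 0 1)).prod (volume.restrict (Ioc 0 1))) := by
  obtain ⟨C, hC⟩ := exists_norm_mittagLefflerKernel_le hβ1.le (sub_pos.2 hβ1) z
  have hK := measurable_mittagLefflerKernel hβ1.le (sub_pos.2 hβ1) z
  refine ((integrable_indicator_rpow (sub_pos.2 hβ1) (by linarith)).const_mul (C * C)).mono' ?_ ?_
  · refine Measurable.aestronglyMeasurable
      (Measurable.indicator ?_ (measurableSet_lt measurable_fst measurable_snd))
    exact ((hK.comp measurable_fst).mul
      (Complex.continuous_conj.measurable.comp (hK.comp measurable_snd))).mul (by fun_prop)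
  · rw [Measure.prod_restrict]
    refine (ae_restrict_iff' (measurableSet_Ioc.prod measurableSet_Ioc)).2
      (ae_of_all _ fun p hp => ?_)
    by_cases h : p.1 < p.2
    · simp only [indicator, mem_ofPred_eq, h, if_true]
      have h1 := Real.rpow_nonneg (sub_pos.2 h).le (-(β - 1))
      rw [norm_mul, norm_mul, RCLike.norm_conj, Complex.norm_real, Real.norm_of_nonneg h1]
      calc _ ≤ (C * p.1 ^ (β - 1 - 1)) * (C * p.2 ^ (β - 1 - 1)) * (p.2 - p.1) ^ (-(β - 1)) := by
            have h2 := hC _ hp.1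
            have h3 := hC _ hp.2
            have h4 := (norm_nonneg _).trans h2
            gcongr
        _ = _ := by ring
    · simp [indicator, h]

open ComplexConjugate in
theorem integral_indicator_kernel {β : ℝ} (hβ1 : 1 < β) (hβ2 : β < 2) {z : ℂ}
    (hz : mittagLeffler β β z = 0) :
    ∫ p : ℝ × ℝ, {p : ℝ × ℝ | p.1 < p.2}.indicator
      (fun p => mittagLefflerKernel β (β - 1) z p.1 * conj (mittagLefflerKernel β (β - 1) z p.2) *
        ((p.2 - p.1) ^ (-(β - 1)) : ℝ)) p
      ∂((volume.restrict (Ioc 0 1)).prod (volume.restrict (Ioc 0 1))) =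
      Real.Gamma (2 - β) * (-z * ((∫ t in 0..1, ‖mittagLefflerKernel β β z t‖ ^ 2 : ℝ) : ℂ)) := by
  rw [integral_prod_symm _ (integrable_indicator_kernel hβ1 hβ2 z),
    ← integral_kernel_one_mul_conj hβ1 hz, intervalIntegral.integral_of_le zero_le_one,
    ← integral_const_mul]
  refine setIntegral_congr_fun measurableSet_Ioc fun t ht => ?_
  have hs : ∀ x : ℝ, {p : ℝ × ℝ | p.1 < p.2}.indicator
      (fun p => mittagLefflerKernel β (β - 1) z p.1 * conj (mittagLefflerKernel β (β - 1) z p.2) *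
        (((p.2 - p.1) ^ (-(β - 1)) : ℝ) : ℂ)) (x, t) =
      (Iio t).indicator (fun x => conj (mittagLefflerKernel β (β - 1) z t) *
        ((((t - x) ^ (2 - β - 1) : ℝ) : ℂ) * mittagLefflerKernel β (β - 1) z x)) x := by
    intro x
    simp only [indicator, mem_ofPred_eq, mem_Iio, show 2 - β - 1 = -(β - 1) by ring]
    split_ifs <;> ring
  simp_rw [hs]
  rw [setIntegral_Ioc_indicator_Iio ht.1 ht.2, intervalIntegral.integral_const_mul,
    integral_rpow_mul_mittagLefflerKernel hβ1.le (sub_pos.2 hβ1) (by linarith) ht.1,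
    show β - 1 + (2 - β) = 1 by ring]
  ring

theorem hasDerivAt_integral_cexp_mul {u : ℝ → ℂ} (hu : IntegrableOn u (Ioc 0 1)) (s : ℂ) :
    HasDerivAt (fun s : ℂ => ∫ x in Ioc (0 : ℝ) 1, Complex.exp (Complex.I * s * x) * u x)
      (∫ x in Ioc (0 : ℝ) 1, Complex.I * x * Complex.exp (Complex.I * s * x) * u x) s := by
  have hb : ∀ s' ∈ Metric.ball s 1, ∀ x ∈ Ioc (0 : ℝ) 1,
      ‖Complex.exp (Complex.I * s' * x)‖ ≤ Real.exp (‖s‖ + 1) := by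
    intro s' hs' x hx
    refine (Complex.norm_exp_le_exp_norm _).trans (Real.exp_le_exp.2 ?_)
    have h1 : ‖s'‖ ≤ ‖s‖ + 1 := by
      have := norm_le_norm_add_norm_sub' s' s
      have h2 := mem_ball_iff_norm.1 hs'
      linarith
    rw [norm_mul, norm_mul, Complex.norm_I, one_mul, Complex.norm_real,
      Real.norm_of_nonneg hx.1.le]
    nlinarith [hx.1, hx.2, norm_nonneg s']
  have hcont : ∀ s' : ℂ, Continuous fun x : ℝ => Complex.exp (Complex.I * s' * x) :=
    fun s' => by fun_prop
  refine (hasDerivAt_integral_of_dominated_loc_of_deriv_le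
    (F := fun (s : ℂ) (x : ℝ) => Complex.exp (Complex.I * s * x) * u x)
    (F' := fun (s : ℂ) (x : ℝ) => Complex.I * x * Complex.exp (Complex.I * s * x) * u x)
    (bound := fun x => Real.exp (‖s‖ + 1) * ‖u x‖) (Metric.ball_mem_nhds s one_pos)
    (Eventually.of_forall fun s' => (hcont s').aestronglyMeasurable.mul hu.aestronglyMeasurable)
    ?_ ?_ ?_ (hu.norm.const_mul _) ?_).2
  · refine (hu.norm.const_mul (Real.exp (‖s‖ + 1))).mono'
      ((hcont s).aestronglyMeasurable.mul hu.aestronglyMeasurable) ?_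
    refine (ae_restrict_iff' measurableSet_Ioc).2 (ae_of_all _ fun x hx => ?_)
    rw [norm_mul]
    exact mul_le_mul_of_nonneg_right (hb s (Metric.mem_ball_self one_pos) x hx) (norm_nonneg _)
  · exact (Continuous.aestronglyMeasurable (by fun_prop)).mul hu.aestronglyMeasurable
  · refine (ae_restrict_iff' measurableSet_Ioc).2 (ae_of_all _ fun x hx s' hs' => ?_)
    rw [norm_mul, norm_mul, norm_mul, Complex.norm_I, one_mul, Complex.norm_real,
      Real.norm_of_nonneg hx.1.le]
    refine mul_le_mul_of_nonneg_right ?_ (norm_nonneg _)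
    nlinarith [hb s' hs' x hx, hx.1, hx.2, norm_nonneg (Complex.exp (Complex.I * s' * x))]
  · refine ae_of_all _ fun x s' _ => ?_
    have h := (((hasDerivAt_id s').const_mul Complex.I).mul_const (x : ℂ)).cexp.mul_const (u x)
    refine h.congr_deriv ?_
    simp only [id, mul_one]
    ring

theorem integral_cexp_mul_eq_zero {u : ℝ → ℂ} (hu : IntegrableOn u (Ioc 0 1))
    (h : ∀ r : ℝ, 0 < r → ∫ x in Ioc (0 : ℝ) 1, Complex.exp (Complex.I * r * x) * u x = 0)
    (s : ℂ) : ∫ x in Ioc (0 : ℝ) 1, Complex.exp (Complex.I * s * x) * u x = 0 := by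
  have hd : Differentiable ℂ
      (fun s : ℂ => ∫ x in Ioc (0 : ℝ) 1, Complex.exp (Complex.I * s * x) * u x) :=
    fun s => (hasDerivAt_integral_cexp_mul hu s).differentiableAt
  have hf : ∃ᶠ s in 𝓝[≠] ((0 : ℝ) : ℂ),
      ∫ x in Ioc (0 : ℝ) 1, Complex.exp (Complex.I * s * x) * u x = 0 :=
    frequently_ofReal_nhdsNE (eventually_mem_nhdsWithin.mono fun r hr => h r hr)
  have := AnalyticOnNhd.eq_of_frequently_eq (g := fun _ => (0 : ℂ))
    (hd.differentiableOn.analyticOnNhd isOpen_univ) analyticOnNhd_const hf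
  exact congrFun this s

open FourierTransform in
theorem eq_zero_of_integral_cexp_mul_eq_zero {u : ℝ → ℂ} (hu : Continuous u) (hu0 : u 0 = 0)
    (hu1 : u 1 = 0)
    (h : ∀ r : ℝ, 0 < r → ∫ x in Ioc (0 : ℝ) 1, Complex.exp (Complex.I * r * x) * u x = 0) :
    ∀ x ∈ Icc (0 : ℝ) 1, u x = 0 := by
  have hint : IntegrableOn u (Icc 0 1) := hu.continuousOn.integrableOn_compact isCompact_Icc
  have hz := integral_cexp_mul_eq_zero (hint.mono_set Ioc_subset_Icc_self) h
  have hv : Continuous ((Icc (0 : ℝ) 1).indicator u) := by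
    refine continuous_indicator (fun x hx => ?_) hu.continuousOn
    rw [frontier_Icc zero_le_one] at hx
    rcases hx with rfl | rfl
    · exact hu0
    · exact hu1
  have hF : 𝓕 ((Icc (0 : ℝ) 1).indicator u) = 0 := by
    ext y
    rw [Real.fourier_real_eq_integral_exp_smul]
    have := hz ((-2 * Real.pi * y : ℝ) : ℂ)
    rw [← integral_Icc_eq_integral_Ioc, ← integral_indicator measurableSet_Icc] at this
    rw [Pi.zero_apply, ← this]
    congr 1; ext x
    by_cases hx : x ∈ Icc (0 : ℝ) 1
    · simp only [hx, indicator_of_mem, smul_eq_mul]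
      congr 2
      push_cast
      ring
    · simp only [hx, indicator_of_notMem, not_false_eq_true, smul_zero]
  have hinv := hv.fourierInv_fourier_eq ((integrable_indicator_iff measurableSet_Icc).2 hint)
    (by rw [hF]; exact integrable_zero _ _ _)
  intro x hx
  have hx' := congrFun hinv x
  rw [indicator_of_mem hx, hF] at hx'
  rw [← hx', Real.fourierInv_eq]
  simp

theorem integral_cexp_mul_kernel_sub_one {β : ℝ} (hβ : 1 < β) {z : ℂ}
    (hz : mittagLeffler β β z = 0) (r : ℝ) :
    ∫ x in Ioc (0 : ℝ) 1, Complex.exp (Complex.I * r * x) * mittagLefflerKernel β (β - 1) z x =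
      -(Complex.I * r) *
        ∫ x in Ioc (0 : ℝ) 1, Complex.exp (Complex.I * r * x) * mittagLefflerKernel β β z x := by
  have h1 : mittagLefflerKernel β β z 1 = 0 := by simp [mittagLefflerKernel, hz]
  have hc := continuous_mittagLefflerKernel hβ.le hβ.le z
  have hI := intervalIntegrable_mittagLefflerKernel hβ.le (sub_pos.2 hβ) z 0 1
  rw [← intervalIntegral.integral_of_le zero_le_one, ← intervalIntegral.integral_of_le zero_le_one,
    intervalIntegral.integral_mul_deriv_eq_deriv_mul_of_hasDerivAt
    (u' := fun x : ℝ => Complex.I * r * Complex.exp (Complex.I * r * x))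
    (v := mittagLefflerKernel β β z) (by fun_prop) hc.continuousOn ?_ ?_
    (Continuous.intervalIntegrable (by fun_prop) _ _) hI]
  · rw [h1, mittagLefflerKernel_zero hβ, ← intervalIntegral.integral_const_mul]
    simp only [mul_zero, sub_zero, zero_sub, ← intervalIntegral.integral_neg]
    congr 1; ext t
    ring
  · intro x _
    have h := ((Complex.ofRealCLM.hasDerivAt (x := x)).const_mul (Complex.I * r)).cexp
    refine h.congr_deriv ?_
    simp only [Complex.ofRealCLM_apply, Complex.ofReal_one, mul_one]
    ring
  · intro x hx
    have := hasDerivAt_mittagLefflerKernel hβ.le (sub_pos.2 hβ) (by simpa using hx.1) z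
    rwa [sub_add_cancel] at this

theorem exists_mittagLefflerKernel_ne_zero {β : ℝ} (hβ : 1 < β) (z : ℂ) :
    ∃ x ∈ Icc (0 : ℝ) 1, mittagLefflerKernel β β z x ≠ 0 := by
  by_contra! h
  have hc := continuous_mittagLeffler_mul_rpow hβ.le (zero_lt_one.trans hβ) z
  have hlim : Tendsto (fun t : ℝ => mittagLeffler β β (z * (t ^ β : ℝ))) (𝓝[>] 0)
      (𝓝 (mittagLeffler β β (z * ((0 : ℝ) ^ β : ℝ)))) := (hc.tendsto 0).mono_left inf_le_left
  have hev : ∀ᶠ t : ℝ in 𝓝[>] 0, mittagLeffler β β (z * (t ^ β : ℝ)) = 0 := by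
    filter_upwards [Ioc_mem_nhdsGT (zero_lt_one (α := ℝ))] with t ht
    have h1 := h t ⟨ht.1.le, ht.2⟩
    rw [mittagLefflerKernel, mul_eq_zero, Complex.ofReal_eq_zero] at h1
    exact h1.resolve_left (Real.rpow_pos_of_pos ht.1 _).ne'
  have h0 := tendsto_nhds_unique hlim (tendsto_const_nhds.congr' (hev.mono fun _ ht => ht.symm))
  rw [Real.zero_rpow (by linarith), Complex.ofReal_zero, mul_zero, mittagLeffler_zero,
    inv_eq_zero, Complex.Gamma_ofReal, Complex.ofReal_eq_zero] at h0
  exact (Real.Gamma_pos_of_pos (zero_lt_one.trans hβ)).ne' h0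

theorem integral_norm_sq_integral_cexp_mul_kernel_pos {β : ℝ} (hβ1 : 1 < β) {z : ℂ}
    (hz : mittagLeffler β β z = 0) :
    0 < ∫ r in Ioi (0 : ℝ), r ^ (β - 1 - 1) * Real.exp (-r) *
      ‖∫ x in Ioc (0 : ℝ) 1,
        Complex.exp (Complex.I * r * x) * mittagLefflerKernel β (β - 1) z x‖ ^ 2 := by
  have hw := integrableOn_mittagLefflerKernel hβ1.le (sub_pos.2 hβ1) z
  have hW := continuous_integral_exp_mul hw
  have hnn : ∀ r ∈ Ioi (0 : ℝ), 0 ≤ r ^ (β - 1 - 1) * Real.exp (-r) *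
      ‖∫ x in Ioc (0 : ℝ) 1,
        Complex.exp (Complex.I * r * x) * mittagLefflerKernel β (β - 1) z x‖ ^ 2 := fun r hr => by
    have := Real.rpow_nonneg (mem_Ioi.1 hr).le (β - 1 - 1)
    positivity
  have hint := integrableOn_rpow_mul_exp_mul_norm_sq hw (sub_pos.2 hβ1) one_pos
  simp only [one_mul] at hint
  refine (setIntegral_nonneg measurableSet_Ioi hnn).lt_of_ne' fun h0 => ?_
  rw [integral_eq_zero_iff_of_nonneg_ae
    ((ae_restrict_iff' measurableSet_Ioi).2 (ae_of_all _ hnn)) hint] at h0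
  have heq := Measure.eqOn_open_of_ae_eq h0 isOpen_Ioi
    (((continuousOn_id.rpow_const fun r hr => Or.inl (ne_of_gt hr)).mul
      (by fun_prop)).mul (hW.norm.pow 2).continuousOn) continuousOn_const
  obtain ⟨x, hx, hx0⟩ := exists_mittagLefflerKernel_ne_zero hβ1 z
  refine hx0 (eq_zero_of_integral_cexp_mul_eq_zero
    (continuous_mittagLefflerKernel hβ1.le hβ1.le z) (mittagLefflerKernel_zero hβ1 z)
    (by simp [mittagLefflerKernel, hz]) (fun r hr => ?_) x hx)
  have h1 := heq (mem_Ioi.2 hr)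
  have hr1 := (Real.rpow_pos_of_pos hr (β - 1 - 1)).ne'
  simpa [hr1, integral_cexp_mul_kernel_sub_one hβ1 hz, hr.ne', Real.exp_ne_zero] using h1

theorem re_cexp_mul_neg_of_mittagLeffler_eq_zero {β : ℝ} (hβ1 : 1 < β) (hβ2 : β < 2) {z : ℂ}
    (hz : mittagLeffler β β z = 0) :
    (Complex.exp (-(((β - 1 : ℝ) : ℂ) * (Real.pi / 2)) * Complex.I) * z).re < 0 := by
  have h := (integral_norm_sq_integral_cexp_mul_kernel_pos hβ1 hz).trans_le
    (integral_le_re_half_kernel (integrableOn_mittagLefflerKernel hβ1.le (sub_pos.2 hβ1) z)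
      (sub_pos.2 hβ1) (integrable_indicator_kernel hβ1 hβ2 z))
  rw [integral_indicator_kernel hβ1 hβ2 hz] at h
  set N := ∫ t in (0 : ℝ)..1, ‖mittagLefflerKernel β β z t‖ ^ 2
  have hN : 0 ≤ N := intervalIntegral.integral_nonneg zero_le_one fun t _ => by positivity
  have h1 := Real.Gamma_pos_of_pos (sub_pos.2 hβ1)
  have h2 := Real.Gamma_pos_of_pos (sub_pos.2 hβ2)
  set e := Complex.exp (-(((β - 1 : ℝ) : ℂ) * (Real.pi / 2)) * Complex.I)
  rw [show e * (Real.Gamma (2 - β) * (-z * (N : ℂ))) =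
    ((Real.Gamma (2 - β) * N : ℝ) : ℂ) * -(e * z) by push_cast; ring, Complex.re_ofReal_mul,
    Complex.neg_re] at h
  by_contra! h3
  have : 0 ≤ 2 * Real.Gamma (β - 1) * (Real.Gamma (2 - β) * N) * (e * z).re := by positivity
  linarith

open ComplexConjugate in
theorem mittagLeffler_conj (a b : ℝ) (z : ℂ) :
    mittagLeffler a b (conj z) = conj (mittagLeffler a b z) := by
  rw [mittagLeffler, mittagLeffler, Complex.conj_tsum]
  congr 1; ext k
  rw [map_div₀, map_pow, Complex.Gamma_ofReal, Complex.conj_ofReal]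

theorem mul_pi_div_two_lt_arg {β : ℝ} (hβ1 : 1 < β) (hβ2 : β < 2) {z : ℂ}
    (hz : mittagLeffler β β z = 0) (h0 : 0 ≤ Complex.arg z) : β * Real.pi / 2 < Complex.arg z := by
  have h := re_cexp_mul_neg_of_mittagLeffler_eq_zero hβ1 hβ2 hz
  by_contra! hle
  have hpi := Real.pi_pos
  have hcos : 0 ≤ Real.cos (Complex.arg z - (β - 1) * (Real.pi / 2)) :=
    Real.cos_nonneg_of_neg_pi_div_two_le_of_le (by nlinarith) (by nlinarith)
  rw [← Complex.norm_mul_exp_arg_mul_I z, mul_left_comm, ← Complex.exp_add,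
    show -(((β - 1 : ℝ) : ℂ) * (Real.pi / 2)) * Complex.I + Complex.arg z * Complex.I =
      ((Complex.arg z - (β - 1) * (Real.pi / 2) : ℝ) : ℂ) * Complex.I by push_cast; ring,
    Complex.re_ofReal_mul, Complex.exp_ofReal_mul_I_re] at h
  exact absurd h (not_lt.2 (mul_nonneg (norm_nonneg z) hcos))

end

/-- Every zero of `E_{β,β}` (with `1 < β < 2`) is nonzero and satisfies
`|arg z| > β π / 2`, i.e. lies outside the closed sector `|arg z| ≤ β π / 2`. -/
theorem zeros_of_mittagLeffler_outside_sector
    (β : ℝ) (hβ : β ∈ Set.Ioo (1 : ℝ) 2) (z : ℂ)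
    (hz : mittagLeffler β β z = 0) :
    z ≠ 0 ∧ β * Real.pi / 2 < |Complex.arg z| := by
  constructor
  · rintro rfl
    rw [mittagLeffler_zero, inv_eq_zero, Complex.Gamma_ofReal, Complex.ofReal_eq_zero] at hz
    exact (Real.Gamma_pos_of_pos (zero_lt_one.trans hβ.1)).ne' hz
  · rcases le_total 0 (Complex.arg z) with h | h
    · exact (mul_pi_div_two_lt_arg hβ.1 hβ.2 hz h).trans_le (le_abs_self _)
    · have hc : Complex.arg (starRingEnd ℂ z) = -Complex.arg z := by
        rw [Complex.arg_conj, if_neg]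
        intro hpi
        linarith [Real.pi_pos]
      rw [abs_of_nonpos h, ← hc]
      refine mul_pi_div_two_lt_arg hβ.1 hβ.2 ?_ (by rw [hc]; linarith)
      rw [mittagLeffler_conj, hz, map_zero]
end

section
/- Let β ∈ (1,2) be real and let λ ∈ ℂ be a zero of E_{β,β} (i.e., E_{β,β}(λ) = 0). Then ∫₀¹ x^{β−1} E_{β,β}(λ x^β) · (1−x)^{β−1} E_{β,β}(λ (1−x)^β) dx = ∑_{k=1}^∞ k λ^{k−1} / Γ(βk + β), where the series on the right converges absolutely. -/
open Real MeasureTheory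

theorem factorial_le_Gamma_mul_add {b : ℝ} (hb : 1 ≤ b) (k : ℕ) :
    ((k + 1).factorial : ℝ) ≤ Gamma (b * (k + 1) + b) := by
  rw [← Real.Gamma_nat_eq_factorial]
  have hk : (0 : ℝ) ≤ k := k.cast_nonneg
  apply Real.Gamma_strictMonoOn_Ici.monotoneOn
  · simp only [Set.mem_Ici]; push_cast; linarith
  · simp only [Set.mem_Ici]; nlinarith
  · push_cast; nlinarith

theorem summable_norm_succ_mul_pow_div_Gamma {b : ℝ} (hb : 1 ≤ b) (l : ℂ) :
    Summable (fun k : ℕ =>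
      ‖((k + 1 : ℕ) : ℂ) * l ^ k / Complex.Gamma ((b * (k + 1) + b : ℝ) : ℂ)‖) := by
  refine (Real.summable_pow_div_factorial ‖l‖).of_nonneg_of_le (fun _ => norm_nonneg _) fun k => ?_
  have h := factorial_le_Gamma_mul_add hb k
  have hf : (0 : ℝ) < ((k + 1).factorial : ℝ) := by positivity
  rw [Complex.Gamma_ofReal, norm_div, norm_mul, norm_pow, Complex.norm_natCast,
    Complex.norm_of_nonneg (hf.le.trans h)]
  calc ((k + 1 : ℕ) : ℝ) * ‖l‖ ^ k / Gamma (b * (k + 1) + b)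
      ≤ ((k + 1 : ℕ) : ℝ) * ‖l‖ ^ k / ((k + 1).factorial : ℝ) := by gcongr
    _ = ‖l‖ ^ k / k.factorial := by
        rw [Nat.factorial_succ]; push_cast; field_simp

theorem summable_norm_mittagLeffler {b : ℝ} (hb : 1 ≤ b) (z : ℂ) :
    Summable (fun k : ℕ => ‖z ^ k / Complex.Gamma ((b * k + b : ℝ) : ℂ)‖) := by
  rw [← summable_nat_add_iff 1]
  refine ((summable_norm_succ_mul_pow_div_Gamma hb z).mul_left ‖z‖).of_nonneg_of_le
    (fun _ => norm_nonneg _) fun k => ?_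
  rw [← norm_mul]
  simp only [norm_div, norm_mul, norm_pow, Complex.norm_natCast, pow_succ']
  push_cast
  rw [mul_div_assoc, mul_div_assoc]
  gcongr
  exact le_mul_of_one_le_left (by positivity) (by linarith [k.cast_nonneg (α := ℝ)])

theorem rpow_mul_mittagLeffler_hasSum {b : ℝ} (hb : 1 ≤ b) (l : ℂ) {x : ℝ} (hx : 0 ≤ x) :
    HasSum (fun k : ℕ => l ^ k / Complex.Gamma ((b * k + b : ℝ) : ℂ) *
      ((x ^ (b * k + b - 1) : ℝ) : ℂ))
      (((x ^ (b - 1) : ℝ) : ℂ) * mittagLeffler b b (l * ((x ^ b : ℝ) : ℂ))) := by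
  have h := (summable_norm_mittagLeffler hb (l * ((x ^ b : ℝ) : ℂ))).of_norm.hasSum.mul_left
    ((x ^ (b - 1) : ℝ) : ℂ)
  refine (congrArg (HasSum · _) (funext fun k => ?_)).mpr h
  have hxk : x ^ (b * k + b - 1) = x ^ (b - 1) * (x ^ b) ^ k := by
    rw [← Real.rpow_mul_natCast hx, ← Real.rpow_add_of_nonneg hx (by linarith) (by positivity)]
    congr 1; ring
  rw [hxk]
  push_cast
  ring

theorem integral_rpow_mul_one_sub_rpow {u v : ℝ} (hu : 0 < u) (hv : 0 < v) :
    ∫ x in (0:ℝ)..1, ((x ^ (u - 1) : ℝ) : ℂ) * (((1 - x) ^ (v - 1) : ℝ) : ℂ) =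
      Complex.Gamma u * Complex.Gamma v / Complex.Gamma ((u + v : ℝ) : ℂ) := by
  rw [Complex.ofReal_add, ← Complex.betaIntegral_eq_Gamma_mul_div _ _ (by simpa) (by simpa),
    Complex.betaIntegral]
  refine intervalIntegral.integral_congr fun x hx => ?_
  rw [Set.uIcc_of_le zero_le_one] at hx
  have h1 : 0 ≤ 1 - x := by linarith [hx.2]
  simp only [Complex.ofReal_cpow hx.1, Complex.ofReal_cpow h1]
  push_cast
  rfl

theorem hasSum_mul_prod {f g : ℕ → ℂ} {s t : ℂ} (hf : HasSum f s) (hg : HasSum g t) :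
    HasSum (fun p : ℕ × ℕ => f p.1 * g p.2) (s * t) :=
  hf.mul hg (summable_mul_of_summable_norm hf.summable.norm hg.summable.norm)

theorem hasSum_integral_rpow_mul_mittagLeffler {b : ℝ} (hb : 1 ≤ b) (l : ℂ) :
    HasSum (fun p : ℕ × ℕ =>
      l ^ (p.1 + p.2) / Complex.Gamma ((b * ((p.1 + p.2 : ℕ) + 1) + b : ℝ) : ℂ))
      (∫ x in (0:ℝ)..1,
        ((x ^ (b - 1) : ℝ) : ℂ) * mittagLeffler b b (l * ((x ^ b : ℝ) : ℂ)) *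
          (((1 - x) ^ (b - 1) : ℝ) : ℂ) *
            mittagLeffler b b (l * (((1 - x) ^ b : ℝ) : ℂ))) := by
  have hb0 : 0 < b := by linarith
  have hpos (k : ℕ) : 0 < b * k + b := by positivity
  have hexp (k : ℕ) : 0 ≤ b * k + b - 1 := by nlinarith [mul_nonneg hb0.le k.cast_nonneg (α := ℝ)]
  set c : ℕ → ℂ := fun k => l ^ k / Complex.Gamma ((b * k + b : ℝ) : ℂ) with hc
  have hcs : Summable fun k => ‖c k‖ := summable_norm_mittagLeffler hb l
  have key := intervalIntegral.hasSum_integral_of_dominated_convergence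
    (μ := volume) (a := 0) (b := 1)
    (F := fun (p : ℕ × ℕ) (x : ℝ) => (c p.1 * ((x ^ (b * p.1 + b - 1) : ℝ) : ℂ)) *
      (c p.2 * (((1 - x) ^ (b * p.2 + b - 1) : ℝ) : ℂ)))
    (f := fun x : ℝ => ((x ^ (b - 1) : ℝ) : ℂ) * mittagLeffler b b (l * ((x ^ b : ℝ) : ℂ)) *
          (((1 - x) ^ (b - 1) : ℝ) : ℂ) *
            mittagLeffler b b (l * (((1 - x) ^ b : ℝ) : ℂ)))
    (fun p _ => ‖c p.1‖ * ‖c p.2‖) ?_ ?_ ?_ ?_ ?_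
  · refine (congrArg (HasSum · _) (funext fun p => ?_)).mpr key
    have hu := hpos p.1
    have hv := hpos p.2
    have hu0 : Complex.Gamma ((b * p.1 + b : ℝ) : ℂ) ≠ 0 :=
      Complex.Gamma_ne_zero_of_re_pos (by simpa only [Complex.ofReal_re])
    have hv0 : Complex.Gamma ((b * p.2 + b : ℝ) : ℂ) ≠ 0 :=
      Complex.Gamma_ne_zero_of_re_pos (by simpa only [Complex.ofReal_re])
    simp only [mul_mul_mul_comm (c p.1)]
    rw [intervalIntegral.integral_const_mul, integral_rpow_mul_one_sub_rpow hu hv]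
    have hsum : b * p.1 + b + (b * p.2 + b) = b * ((p.1 + p.2 : ℕ) + 1) + b := by
      push_cast; ring
    rw [hsum, pow_add]
    simp only [hc]
    generalize Complex.Gamma ((b * p.1 + b : ℝ) : ℂ) = u at hu0 ⊢
    generalize Complex.Gamma ((b * p.2 + b : ℝ) : ℂ) = v at hv0 ⊢
    field_simp
  · intro p
    exact Measurable.aestronglyMeasurable (by fun_prop)
  · refine fun p => .of_forall fun x hx => ?_
    rw [Set.uIoc_of_le zero_le_one] at hx
    have h1 : 0 ≤ 1 - x := by linarith [hx.2]
    rw [norm_mul, norm_mul, norm_mul, Complex.norm_of_nonneg (rpow_nonneg hx.1.le _),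
      Complex.norm_of_nonneg (rpow_nonneg h1 _)]
    gcongr
    · exact mul_le_of_le_one_right (norm_nonneg _) (rpow_le_one hx.1.le hx.2 (hexp _))
    · exact mul_le_of_le_one_right (norm_nonneg _)
        (rpow_le_one h1 (by linarith [hx.1]) (hexp _))
  · exact .of_forall fun x _ => hcs.mul_of_nonneg hcs (fun _ => norm_nonneg _)
      (fun _ => norm_nonneg _)
  · exact intervalIntegrable_const
  · refine .of_forall fun x hx => ?_
    rw [Set.uIoc_of_le zero_le_one] at hx
    have h1 : 0 ≤ 1 - x := by linarith [hx.2]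
    simp only [mul_assoc (_ * mittagLeffler b b _)]
    exact hasSum_mul_prod (f := fun k => c k * ((x ^ (b * k + b - 1) : ℝ) : ℂ))
      (g := fun k => c k * (((1 - x) ^ (b * k + b - 1) : ℝ) : ℂ))
      (rpow_mul_mittagLeffler_hasSum hb l hx.1.le) (rpow_mul_mittagLeffler_hasSum hb l h1)

theorem hasSum_antidiagonal_const {f : ℕ → ℂ} {a : ℂ}
    (h : HasSum (fun p : ℕ × ℕ => f (p.1 + p.2)) a) :
    HasSum (fun k : ℕ => ((k + 1 : ℕ) : ℂ) * f k) a := by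
  rw [← Equiv.hasSum_iff Finset.HasAntidiagonal.sigmaAntidiagonalEquivProd] at h
  refine h.sigma fun k => ?_
  have hk := Finset.hasSum (Finset.HasAntidiagonal.antidiagonal k) fun p : ℕ × ℕ => f (p.1 + p.2)
  rw [Finset.sum_congr rfl (g := fun _ => f k)
    fun p hp => by rw [Finset.HasAntidiagonal.mem_antidiagonal.mp hp], Finset.sum_const,
    Finset.Nat.card_antidiagonal, nsmul_eq_mul] at hk
  exact hk

/-- For `1 < β < 2` and `λ` a zero of `E_{β,β}`, the inner product
`∫₀¹ x^{β−1} E_{β,β}(λ x^β) (1−x)^{β−1} E_{β,β}(λ (1−x)^β) dx`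
equals the absolutely convergent series `∑_{k=1}^∞ k λ^{k−1} / Γ(β k + β)`. -/
theorem integral_eigenfunction_product_eq_series
    (β : ℝ) (hβ : β ∈ Set.Ioo (1 : ℝ) 2) (l : ℂ)
    (hl : mittagLeffler β β l = 0) :
    Summable (fun k : ℕ =>
      ‖((k + 1 : ℕ) : ℂ) * l ^ k / Complex.Gamma ((β * (k + 1) + β : ℝ) : ℂ)‖) ∧
    ∫ x in (0:ℝ)..1,
        ((x ^ (β - 1) : ℝ) : ℂ) * mittagLeffler β β (l * ((x ^ β : ℝ) : ℂ)) *
          (((1 - x) ^ (β - 1) : ℝ) : ℂ) *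
            mittagLeffler β β (l * (((1 - x) ^ β : ℝ) : ℂ))
      = ∑' k : ℕ, ((k + 1 : ℕ) : ℂ) * l ^ k /
          Complex.Gamma ((β * (k + 1) + β : ℝ) : ℂ) := by
  refine ⟨summable_norm_succ_mul_pow_div_Gamma hβ.1.le l, ?_⟩
  rw [← (hasSum_antidiagonal_const
    (f := fun k => l ^ k / Complex.Gamma ((β * (k + 1) + β : ℝ) : ℂ))
    (hasSum_integral_rpow_mul_mittagLeffler hβ.1.le l)).tsum_eq]
  simp only [mul_div_assoc]
end
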